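/- arXiv:1907.09796 — 2 statements merged into one kernel-verified Lean document; each statement's English description precedes it below -/
import Mathlib

section
/- Let A_{-1}, A_0, A_1, G be as in the context, with G𝟙 = 𝟙, and let σ < 1 be a real number such that (A_{-1} − A_1)𝟙 ≥ (1 − σ)𝟙 entrywise. Let X : ℕ → B(ℓ∞) satisfy: X_0 is positive with X_0𝟙 = 𝟙, and X_{k+1} = A_{-1} + A_0X_k + A_1X_k² for all k. Then every X_k is positive with X_k𝟙 = 𝟙, the error E_k := G − X_k satisfies E_k𝟙 = 0, and for every w ∈ ℓ∞ and λ ∈ ℝ with Gw = λw one has ‖E_{k+1} w‖ ≤ ‖(|λ|+1)A_1 + A_0‖ · ‖E_k w‖ for all k. -/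
open BoundedContinuousFunction Filter

noncomputable section

/-- ℓ∞: the Banach space of bounded real sequences with the sup norm. -/
abbrev Linf : Type := BoundedContinuousFunction ℕ ℝ

/-- A sequence is nonnegative if all its entries are nonnegative. -/
def vnonneg (x : Linf) : Prop := ∀ i, 0 ≤ x i

/-- An operator in B(ℓ∞) is positive if it maps nonnegative sequences to
nonnegative sequences. -/
def OpPos (A : Linf →L[ℝ] Linf) : Prop := ∀ x : Linf, vnonneg x → vnonneg (A x)

/-- The constant sequence with all entries equal to one. -/
def ones : Linf := BoundedContinuousFunction.const ℕ (1 : ℝ)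

theorem mul_apply_eq (S T : Linf →L[ℝ] Linf) (x : Linf) : (S * T) x = S (T x) :=
  rfl

/-- Composition of positive operators is positive. -/
theorem OpPos.mul {A B : Linf →L[ℝ] Linf} (hA : OpPos A) (hB : OpPos B) : OpPos (A * B) :=
  fun x hx => hA _ (hB x hx)

theorem OpPos.add {A B : Linf →L[ℝ] Linf} (hA : OpPos A) (hB : OpPos B) : OpPos (A + B) :=
  fun x hx i => add_nonneg (hA x hx i) (hB x hx i)

/-- A positive operator is dominated entrywise by its action on the constant sequence. -/
theorem OpPos.abs_apply_le {A : Linf →L[ℝ] Linf} (hA : OpPos A) (x : Linf) (i : ℕ) :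
    |A x i| ≤ A ones i * ‖x‖ := by
  have hx : ∀ j, |x j| ≤ ‖x‖ := fun j => x.norm_coe_le_norm j
  have h₁ := hA (‖x‖ • ones - x) (fun j => by
    simpa [ones] using (abs_le.mp (hx j)).2) i
  have h₂ := hA (‖x‖ • ones + x) (fun j => by
    have := (abs_le.mp (hx j)).1
    simp only [ones, BoundedContinuousFunction.coe_add, Pi.add_apply,
      BoundedContinuousFunction.coe_smul, BoundedContinuousFunction.const_apply, smul_eq_mul]
    linarith) i
  simp only [map_sub, map_add, map_smul, BoundedContinuousFunction.coe_sub, Pi.sub_apply,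
    BoundedContinuousFunction.coe_add, Pi.add_apply, BoundedContinuousFunction.coe_smul,
    smul_eq_mul] at h₁ h₂
  rw [abs_le]
  constructor <;> linarith

theorem norm_ones : ‖ones‖ = 1 := by
  simp [ones]

/-- Iteration F₁ with a row-stochastic starting matrix: the iterates remain
row-stochastic, the error kills 𝟙, and the error along eigenvectors of G
contracts with factor ‖(|λ|+1)A₁ + A₀‖. -/
theorem stmt4
    (Am1 A0 A1 G : Linf →L[ℝ] Linf)
    (hAm1 : OpPos Am1) (hA0 : OpPos A0) (hA1 : OpPos A1) (hG : OpPos G)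
    (hstoch : (Am1 + A0 + A1) ones = ones)
    (heq : A1 * G ^ 2 + A0 * G + Am1 = G)
    (hG1 : G ones = ones)
    (σ : ℝ) (hσ : σ < 1)
    (hgap : ∀ i, 1 - σ ≤ ((Am1 - A1) ones) i)
    (X : ℕ → Linf →L[ℝ] Linf)
    (hX0 : OpPos (X 0)) (hX01 : (X 0) ones = ones)
    (hXrec : ∀ k, X (k + 1) = Am1 + A0 * X k + A1 * (X k) ^ 2) :
    (∀ k, OpPos (X k) ∧ (X k) ones = ones) ∧
    (∀ k, (G - X k) ones = 0) ∧
    ∀ (w : Linf) (lam : ℝ), G w = lam • w →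
      ∀ k, ‖(G - X (k + 1)) w‖ ≤ ‖(|lam| + 1) • A1 + A0‖ * ‖(G - X k) w‖ := by
  have hX : ∀ k, OpPos (X k) ∧ (X k) ones = ones := by
    intro k
    induction k with
    | zero => exact ⟨hX0, hX01⟩
    | succ k ih =>
      obtain ⟨hpos, hone⟩ := ih
      rw [hXrec k, pow_two]
      refine ⟨(hAm1.add (hA0.mul hpos)).add (hA1.mul (hpos.mul hpos)), ?_⟩
      simpa [hone] using hstoch
  refine ⟨hX, fun k => by simp [hG1, (hX k).2], fun w lam hw k => ?_⟩
  set v : Linf := (G - X k) w with hv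
  have herr : (G - X (k + 1)) w = A0 v + lam • A1 v + (A1 * X k) v := by
    have hGw := congrArg (fun T : Linf →L[ℝ] Linf => T w) heq
    simp only [pow_two, _root_.add_apply, mul_apply_eq, hw,
      map_smul] at hGw
    rw [hXrec k, hv]
    simp only [pow_two, _root_.add_apply, _root_.sub_apply,
      mul_apply_eq, hw, map_smul, map_sub]
    rw [← hGw]
    module
  set B : Linf →L[ℝ] Linf := (|lam| + 1) • A1 + A0 with hB
  rw [herr, BoundedContinuousFunction.norm_le (by positivity)]
  intro i
  have h0 := hA0.abs_apply_le v i
  have h1 := mul_le_mul_of_nonneg_left (hA1.abs_apply_le v i) (abs_nonneg lam)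
  have h2 : |(A1 * X k) v i| ≤ A1 ones i * ‖v‖ := by
    simpa [(hX k).2] using (hA1.mul (hX k).1).abs_apply_le v i
  have hBi : B ones i ≤ ‖B‖ :=
    calc B ones i ≤ ‖B ones‖ := (le_abs_self _).trans ((B ones).norm_coe_le_norm i)
      _ ≤ ‖B‖ * ‖ones‖ := B.le_opNorm _
      _ = ‖B‖ := by rw [norm_ones, mul_one]
  calc ‖(A0 v + lam • A1 v + (A1 * X k) v) i‖
      ≤ |A0 v i| + |lam * A1 v i| + |(A1 * X k) v i| := abs_add_three _ _ _
    _ = |A0 v i| + |lam| * |A1 v i| + |(A1 * X k) v i| := by rw [abs_mul]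
    _ ≤ A0 ones i * ‖v‖ + |lam| * (A1 ones i * ‖v‖) + A1 ones i * ‖v‖ := by gcongr
    _ = B ones i * ‖v‖ := by
      simp only [hB, _root_.add_apply, _root_.smul_apply,
        BoundedContinuousFunction.coe_add, Pi.add_apply, BoundedContinuousFunction.coe_smul,
        smul_eq_mul]
      ring
    _ ≤ ‖B‖ * ‖v‖ := by gcongr
end
end

section
/- Let A_{-1}, A_0, A_1, G be as in the context, with G𝟙 ≤ 𝟙 entrywise. Let θ > 0 and γ ≥ 0 be real numbers such that θ𝟙 ≤ A_{-1}𝟙 and A_1𝟙 ≤ γ·A_{-1}𝟙 entrywise. Then W := I − A_0 − A_1G is invertible in B(ℓ∞) and ‖W^{-1}A_1‖ ≤ γ. -/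
open BoundedContinuousFunction Filter

noncomputable section

lemma OpPos.apply_le_apply {A : Linf →L[ℝ] Linf} (hA : OpPos A) {x y : Linf}
    (h : ∀ i, x i ≤ y i) (i : ℕ) : A x i ≤ A y i := by
  have h0 := hA (y - x) (fun j => by simpa using h j) i
  simpa using h0

/-- A positive operator is bounded in norm by any upper bound of its value at `ones`. -/
lemma OpPos.norm_le {A : Linf →L[ℝ] Linf} (hA : OpPos A) {c : ℝ} (hc : 0 ≤ c)
    (h : ∀ i, A ones i ≤ c) : ‖A‖ ≤ c := by
  refine A.opNorm_le_bound hc fun x => ?_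
  refine (BoundedContinuousFunction.norm_le (by positivity)).2 fun i => ?_
  have hx (j : ℕ) := abs_le.1 (x.norm_coe_le_norm j)
  have h1 : A x i ≤ A (‖x‖ • ones) i :=
    hA.apply_le_apply (fun j => by simpa [ones] using (hx j).2) i
  have h2 : A (-‖x‖ • ones) i ≤ A x i :=
    hA.apply_le_apply (fun j => by simpa [ones] using (hx j).1) i
  have h3 := mul_le_mul_of_nonneg_left (h i) (norm_nonneg x)
  simp only [map_smul, BoundedContinuousFunction.coe_smul, smul_eq_mul] at h1 h2
  rw [Real.norm_eq_abs, abs_le]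
  constructor <;> linarith

/-- Minimum principle for `1 - K`, where `K` is positive and `K ones` is uniformly below one. -/
lemma OpPos.vnonneg_of_one_sub {K : Linf →L[ℝ] Linf} (hK : OpPos K) {θ : ℝ} (hθ : 0 < θ)
    (h : ∀ i, K ones i ≤ 1 - θ) {y : Linf} (hy : vnonneg ((1 - K) y)) : vnonneg y := by
  have hbdd : BddBelow (Set.range y) :=
    ⟨-‖y‖, by rintro _ ⟨i, rfl⟩; exact (abs_le.1 (y.norm_coe_le_norm i)).1⟩
  have hs (i : ℕ) : iInf y ≤ y i := ciInf_le hbdd i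
  suffices 0 ≤ iInf y from fun i => this.trans (hs i)
  by_contra! hneg
  have key : iInf y * (1 - θ) ≤ iInf y := le_ciInf fun i => by
    have h1 : K (iInf y • ones) i ≤ K y i :=
      hK.apply_le_apply (fun j => by simpa [ones] using hs j) i
    have h2 : 0 ≤ y i - K y i := by simpa using hy i
    have h3 := mul_le_mul_of_nonpos_left (h i) hneg.le
    simp only [map_smul, BoundedContinuousFunction.coe_smul, smul_eq_mul] at h1
    linarith
  nlinarith

/-- W = I - A₀ - A₁G is invertible in B(ℓ∞) and ‖W⁻¹A₁‖ ≤ γ, provided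
θ𝟙 ≤ A₋₁𝟙, A₁𝟙 ≤ γ·A₋₁𝟙 and G𝟙 ≤ 𝟙. -/
theorem stmt9
    (Am1 A0 A1 G : Linf →L[ℝ] Linf)
    (hAm1 : OpPos Am1) (hA0 : OpPos A0) (hA1 : OpPos A1) (hG : OpPos G)
    (hstoch : (Am1 + A0 + A1) ones = ones)
    (heq : A1 * G ^ 2 + A0 * G + Am1 = G)
    (hG1 : ∀ i, (G ones) i ≤ 1)
    (θ γ : ℝ) (hθpos : 0 < θ) (hγ : 0 ≤ γ)
    (hθ : ∀ i, θ ≤ (Am1 ones) i)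
    (hγle : ∀ i, (A1 ones) i ≤ γ * (Am1 ones) i) :
    ∃ Winv : Linf →L[ℝ] Linf,
      (1 - A0 - A1 * G) * Winv = 1 ∧ Winv * (1 - A0 - A1 * G) = 1 ∧
      ‖Winv * A1‖ ≤ γ := by
  set K : Linf →L[ℝ] Linf := A0 + A1 * G with hKdef
  have hW : 1 - A0 - A1 * G = 1 - K := by
    ext x i
    simp [hKdef, sub_sub]
  have hKpos : OpPos K := fun x hx i => by
    have h1 := hA0 x hx i
    have h2 := hA1 _ (hG x hx) i
    simpa [hKdef] using add_nonneg h1 h2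
  have hKle (i : ℕ) : K ones i ≤ 1 - Am1 ones i := by
    have h1 : A1 (G ones) i ≤ A1 ones i :=
      hA1.apply_le_apply (fun j => by simpa [ones] using hG1 j) i
    have h2 : Am1 ones i + A0 ones i + A1 ones i = 1 := by
      simpa [ones] using congrArg (fun f : Linf => f i) hstoch
    have h3 : K ones i = A0 ones i + A1 (G ones) i := by simp [hKdef]
    linarith
  have hKθ (i : ℕ) : K ones i ≤ 1 - θ := by linarith [hKle i, hθ i]
  have hθ1 : 0 ≤ 1 - θ :=
    (hKpos ones (fun j => by simp [ones]) 0).trans (hKθ 0)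
  have hKnorm : ‖K‖ < 1 := (hKpos.norm_le hθ1 hKθ).trans_lt (by linarith)
  obtain ⟨u, hu⟩ := isUnit_one_sub_of_norm_lt_one (R := Linf →L[ℝ] Linf) hKnorm
  have hright : (1 - K) * (↑u⁻¹ : Linf →L[ℝ] Linf) = 1 := by rw [← hu, u.mul_inv]
  have hleft : (↑u⁻¹ : Linf →L[ℝ] Linf) * (1 - K) = 1 := by rw [← hu, u.inv_mul]
  have hWinv (x : Linf) : (1 - K) ((↑u⁻¹ : Linf →L[ℝ] Linf) x) = x :=
    congrArg (fun T : Linf →L[ℝ] Linf => T x) hright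
  have hpos : OpPos ((↑u⁻¹ : Linf →L[ℝ] Linf) * A1) := fun x hx =>
    hKpos.vnonneg_of_one_sub hθpos hKθ (by
      rw [mul_apply_eq_comp, hWinv]
      exact hA1 x hx)
  refine ⟨↑u⁻¹, by rw [hW, hright], by rw [hW, hleft], hpos.norm_le hγ fun i => ?_⟩
  have hdiff : vnonneg (γ • ones - (↑u⁻¹ : Linf →L[ℝ] Linf) (A1 ones)) :=
    hKpos.vnonneg_of_one_sub hθpos hKθ fun j => by
      rw [map_sub, hWinv, map_smul]
      have h1 := mul_le_mul_of_nonneg_left (hKle j) hγ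
      have h2 := hγle j
      have h3 : (γ • (1 - K) ones - A1 ones) j = γ * (1 - K ones j) - A1 ones j := by
        simp [ones]
      rw [h3]
      linarith
  have h4 := hdiff i
  simpa [ones] using h4
end
end
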